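/- Fix a real constant c ≠ 0 and for t ≥ 0 define c(t) by c(t)⁻¹ = ∫₀^∞ (1 + t λ²/c²)^{−1/2} · (2/(π(1+λ²))) dλ. Then c(t) ≥ 1 for every t ≥ 0, and there exists a finite constant C̃ (depending only on c) such that c(t) ≤ C̃ √(1 + t) for every t ≥ 0. -/

import Mathlib

open MeasureTheory

/-- The normalizing constant `c(t)` of the conditional prior of a local
shrinkage parameter given the global shrinkage parameter `t = τ²` in the
regularized Horseshoe variant of Nishimura and Suchard:
`c(t)⁻¹ = ∫₀^∞ (1 + t λ²/c²)^{−1/2} (2/(π(1+λ²))) dλ`. -/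
noncomputable def nsNormConst (c t : ℝ) : ℝ :=
  (∫ l in Set.Ioi (0 : ℝ),
    (1 + t * l ^ 2 / c ^ 2) ^ (-(1 / 2 : ℝ)) * (2 / (Real.pi * (1 + l ^ 2))))⁻¹

lemma ns_int_c : IntegrableOn (fun l : ℝ => 2 / (Real.pi * (1 + l ^ 2))) (Set.Ioi 0) := by
  have h := (integrable_inv_one_add_sq.const_mul (2 / Real.pi)).integrableOn (s := Set.Ioi (0 : ℝ))
  refine h.congr_fun (fun l _ => ?_) measurableSet_Ioi
  have : (1 + l ^ 2) ≠ 0 := by positivity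
  field_simp

lemma ns_val_c : ∫ l in Set.Ioi (0 : ℝ), 2 / (Real.pi * (1 + l ^ 2)) = 1 := by
  have h : ∀ l : ℝ, 2 / (Real.pi * (1 + l ^ 2)) = (2 / Real.pi) * (1 + l ^ 2)⁻¹ := by
    intro l
    have : (1 + l ^ 2) ≠ 0 := by positivity
    field_simp
  simp_rw [h]
  rw [integral_const_mul, integral_Ioi_inv_one_add_sq, Real.arctan_zero]
  have := Real.pi_ne_zero
  field_simp
  ring

lemma ns_le (c t l : ℝ) (ht : 0 ≤ t) :
    (1 + t * l ^ 2 / c ^ 2) ^ (-(1 / 2 : ℝ)) * (2 / (Real.pi * (1 + l ^ 2)))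
      ≤ 2 / (Real.pi * (1 + l ^ 2)) := by
  have h0 : 0 ≤ t * l ^ 2 / c ^ 2 := by positivity
  have h1 : (1 + t * l ^ 2 / c ^ 2) ^ (-(1 / 2 : ℝ)) ≤ 1 :=
    Real.rpow_le_one_of_one_le_of_nonpos (by linarith) (by norm_num)
  have := Real.pi_pos
  exact mul_le_of_le_one_left (by positivity) h1

lemma ns_nonneg (c t l : ℝ) (ht : 0 ≤ t) :
    0 ≤ (1 + t * l ^ 2 / c ^ 2) ^ (-(1 / 2 : ℝ)) * (2 / (Real.pi * (1 + l ^ 2))) := by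
  have := Real.pi_pos
  positivity

lemma ns_int (c t : ℝ) (ht : 0 ≤ t) : IntegrableOn (fun l : ℝ =>
    (1 + t * l ^ 2 / c ^ 2) ^ (-(1 / 2 : ℝ)) * (2 / (Real.pi * (1 + l ^ 2)))) (Set.Ioi 0) := by
  refine Integrable.mono' ns_int_c (Measurable.aestronglyMeasurable (by fun_prop))
    (Filter.Eventually.of_forall fun l => ?_)
  rw [Real.norm_of_nonneg (ns_nonneg c t l ht)]
  exact ns_le c t l ht

lemma ns_lower (c t : ℝ) (hc : c ≠ 0) (ht : 0 ≤ t) :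
    (Real.pi * Real.sqrt (1 + 1 / c ^ 2) * Real.sqrt (1 + t))⁻¹ ≤
    ∫ l in Set.Ioi (0 : ℝ),
      (1 + t * l ^ 2 / c ^ 2) ^ (-(1 / 2 : ℝ)) * (2 / (Real.pi * (1 + l ^ 2))) := by
  have hpi := Real.pi_pos
  have hsub : Set.Ioc (0 : ℝ) 1 ⊆ Set.Ioi 0 := fun x hx => hx.1
  have h1 := setIntegral_mono_set (ns_int c t ht)
    (Filter.Eventually.of_forall fun l => ns_nonneg c t l ht) (LE.le.eventuallyLE hsub)
  refine le_trans ?_ h1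
  have h2 : ∫ l in Set.Ioc (0 : ℝ) 1,
      (Real.pi * Real.sqrt (1 + 1 / c ^ 2) * Real.sqrt (1 + t))⁻¹ =
      (Real.pi * Real.sqrt (1 + 1 / c ^ 2) * Real.sqrt (1 + t))⁻¹ := by simp
  rw [← h2]
  refine setIntegral_mono_on (integrableOn_const (by simp)) ((ns_int c t ht).mono_set hsub) measurableSet_Ioc ?_
  intro l hl
  have hl2 : l ^ 2 ≤ 1 := by nlinarith [hl.1, hl.2]
  have hX : 1 + t * l ^ 2 / c ^ 2 ≤ (1 + 1 / c ^ 2) * (1 + t) := by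
    have h3 : t * l ^ 2 / c ^ 2 ≤ t * 1 / c ^ 2 := by gcongr
    have h4 : 0 ≤ 1 / c ^ 2 := by positivity
    have h5 : t * 1 / c ^ 2 = 1 / c ^ 2 * t := by ring
    nlinarith
  have hpos : 0 < 1 + t * l ^ 2 / c ^ 2 := by positivity
  have hA : (Real.sqrt (1 + 1 / c ^ 2) * Real.sqrt (1 + t))⁻¹ ≤
      (1 + t * l ^ 2 / c ^ 2) ^ (-(1 / 2 : ℝ)) := by
    rw [Real.rpow_neg hpos.le, ← Real.sqrt_eq_rpow, ← Real.sqrt_mul (by positivity)]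
    exact inv_anti₀ (Real.sqrt_pos.2 hpos) (Real.sqrt_le_sqrt hX)
  have hB : Real.pi⁻¹ ≤ 2 / (Real.pi * (1 + l ^ 2)) := by
    rw [le_div_iff₀ (by positivity), ← mul_assoc, inv_mul_cancel₀ hpi.ne']
    linarith
  rw [mul_assoc, mul_inv, mul_comm]
  exact mul_le_mul hA hB (by positivity) (by positivity)

/-- For a fixed real constant `c ≠ 0`, the normalizing
constant `c(t)` satisfies `1 ≤ c(t)` for every `t ≥ 0`, and there is a finite
constant `C̃` (depending only on `c`) with `c(t) ≤ C̃ √(1 + t)` for all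
`t ≥ 0`. -/
theorem stmt12 (c : ℝ) (hc : c ≠ 0) :
    (∀ t : ℝ, 0 ≤ t → 1 ≤ nsNormConst c t) ∧
    ∃ C : ℝ, ∀ t : ℝ, 0 ≤ t → nsNormConst c t ≤ C * Real.sqrt (1 + t) := by
  have hpi := Real.pi_pos
  have hpos : ∀ t : ℝ, 0 ≤ t →
      0 < Real.pi * Real.sqrt (1 + 1 / c ^ 2) * Real.sqrt (1 + t) := fun t ht => by positivity
  refine ⟨fun t ht => ?_, Real.pi * Real.sqrt (1 + 1 / c ^ 2), fun t ht => ?_⟩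
  · refine (one_le_inv₀ (lt_of_lt_of_le (inv_pos.2 (hpos t ht)) (ns_lower c t hc ht))).2 ?_
    exact (integral_mono (ns_int c t ht) ns_int_c fun l => ns_le c t l ht).trans ns_val_c.le
  · exact inv_le_of_inv_le₀ (hpos t ht) (ns_lower c t hc ht)
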